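/- Decomposition of the dual of the Minkowski domain: every continuous linear functional $\ell$ on $(L^{\mathcal{R}}, \|\cdot\|_{\mathcal{R}})$ decomposes uniquely as $\ell = \mu \oplus \lambda$ where $\mu \in \mathbf{ca}_{\mathbb{P}}$ acts by $X \mapsto \int X\, d\mu$ (a bounded functional on $L^{\mathcal{R}}$ with $|\int X d\mu| \le \|\ell\|_{\mathcal{R}*} \|X\|_{\mathcal{R}}$) and $\lambda$ vanishes on $M^{\mathcal{R}} := \mathrm{cl}_{\|\cdot\|_{\mathcal{R}}}(L^{\infty}_{\mathbb{P}})$. The set function $A \mapsto \ell(\mathbf{1}_A)$ is countably additive as a consequence of continuity from above of $\rho_{\mathcal{R}}$. -/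

import Mathlib

/-!
Statement 17 (Theorem R22): Every continuous linear functional on
`(L^R, ‖·‖_R)` decomposes uniquely as a regular (countably additive) part plus
a singular part vanishing on `M^R`, and `A ↦ ℓ(1_A)` is countably additive.
-/

open MeasureTheory ENNReal

variable {Ω : Type*} [MeasurableSpace Ω]

noncomputable def rhoE (D : Set (Measure Ω)) (β : Measure Ω → ℝ)
    (f : Ω → ℝ) : ℝ≥0∞ :=
  ⨆ μ ∈ D, (∫⁻ ω, ENNReal.ofReal |f ω| ∂μ) - ENNReal.ofReal (β μ)

noncomputable def Mnorm (D : Set (Measure Ω)) (β : Measure Ω → ℝ)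
    (X : Ω → ℝ) : ℝ≥0∞ :=
  ⨅ (l : ℝ) (_ : 0 < l) (_ : rhoE D β (fun ω => X ω / l) ≤ 1),
    ENNReal.ofReal l

/-- The Minkowski domain `L^R`. -/
def LRdom (D : Set (Measure Ω)) : Set (Ω → ℝ) :=
  {X | Measurable X ∧ ∀ μ ∈ D, Integrable X μ}

/-- `M^R`, the `‖·‖_R`-closure of `L^∞_ℙ` in `L^R`. -/
def MRdom (D : Set (Measure Ω)) (β : Measure Ω → ℝ) : Set (Ω → ℝ) :=
  {X ∈ LRdom D | ∀ ε : ℝ, 0 < ε → ∃ Y : Ω → ℝ, Measurable Y ∧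
    (∃ C : ℝ, ∀ ω, |Y ω| ≤ C) ∧
    Mnorm D β (fun ω => X ω - Y ω) < ENNReal.ofReal ε}

section MinkowskiGauge

variable {D : Set (Measure Ω)} {β : Measure Ω → ℝ} {X Y : Ω → ℝ}

theorem rhoE_mono (h : ∀ ω, |X ω| ≤ |Y ω|) : rhoE D β X ≤ rhoE D β Y :=
  iSup₂_mono fun _ _ => tsub_le_tsub_right
    (lintegral_mono fun ω => ENNReal.ofReal_le_ofReal (h ω)) _

theorem rhoE_eq_zero_of_ae_eq_zero (h : ∀ μ ∈ D, X =ᵐ[μ] 0) : rhoE D β X = 0 := by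
  refine le_antisymm (iSup₂_le fun μ hμ => ?_) zero_le
  have : ∫⁻ ω, ENNReal.ofReal |X ω| ∂μ = 0 := by
    rw [lintegral_eq_zero_of_ae_eq_zero]
    filter_upwards [h μ hμ] with ω hω
    simp [hω]
  simp [this]

theorem Mnorm_le {l : ℝ} (hl : 0 < l) (h : rhoE D β (fun ω => X ω / l) ≤ 1) :
    Mnorm D β X ≤ ENNReal.ofReal l :=
  iInf_le_of_le l (iInf_le_of_le hl (iInf_le_of_le h le_rfl))

theorem exists_rhoE_le_of_Mnorm_ne_top (h : Mnorm D β X ≠ ⊤) :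
    ∃ l : ℝ, 0 < l ∧ rhoE D β (fun ω => X ω / l) ≤ 1 := by
  by_contra! hc
  refine h ?_
  simp only [Mnorm, iInf_eq_top]
  exact fun l hl hle => absurd hle (not_le.2 (hc l hl))

theorem Mnorm_mono (h : ∀ ω, |X ω| ≤ |Y ω|) : Mnorm D β X ≤ Mnorm D β Y := by
  refine le_iInf fun l => le_iInf fun hl => le_iInf fun hY => Mnorm_le hl ?_
  refine (rhoE_mono fun ω => ?_).trans hY
  rw [abs_div, abs_div]
  exact div_le_div_of_nonneg_right (h ω) (abs_nonneg l)

theorem Mnorm_eq_zero_of_ae_eq_zero (h : ∀ μ ∈ D, X =ᵐ[μ] 0) : Mnorm D β X = 0 := by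
  refine le_antisymm (ENNReal.le_of_forall_pos_le_add fun ε hε _ => ?_) zero_le
  have hle : rhoE D β (fun ω => X ω / (ε : ℝ)) ≤ 1 := by
    rw [rhoE_eq_zero_of_ae_eq_zero]
    · exact zero_le
    · intro μ hμ
      filter_upwards [h μ hμ] with ω hω
      simp [hω]
  simpa using Mnorm_le (NNReal.coe_pos.2 hε) hle

theorem tendsto_Mnorm_indicator {A : ℕ → Set Ω}
    (h : ∀ l : ℝ, 0 < l → Filter.Tendsto
      (fun n => rhoE D β (fun ω => l * Set.indicator (A n) (fun _ => (1 : ℝ)) ω))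
      Filter.atTop (nhds 0)) :
    Filter.Tendsto (fun n => Mnorm D β (Set.indicator (A n) fun _ => (1 : ℝ)))
      Filter.atTop (nhds 0) := by
  rw [ENNReal.tendsto_nhds_zero]
  intro ε hε
  obtain ⟨δ, hδ, hδε⟩ := ENNReal.lt_iff_exists_nnreal_btwn.1 hε
  have hδ' : (0 : ℝ) < δ := by exact_mod_cast hδ
  filter_upwards [(ENNReal.tendsto_nhds_zero.1 (h (δ : ℝ)⁻¹ (inv_pos.2 hδ')) 1 one_pos)] with n hn
  refine (Mnorm_le hδ' ?_).trans (by simpa using hδε.le)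
  simpa only [div_eq_inv_mul] using hn

theorem LRdom_of_abs_le (hX : X ∈ LRdom D) (hY : Measurable Y) (h : ∀ ω, |Y ω| ≤ |X ω|) :
    Y ∈ LRdom D :=
  ⟨hY, fun μ hμ => (hX.2 μ hμ).mono hY.aestronglyMeasurable (.of_forall h)⟩

theorem LRdom_add (hX : X ∈ LRdom D) (hY : Y ∈ LRdom D) : X + Y ∈ LRdom D :=
  ⟨hX.1.add hY.1, fun μ hμ => (hX.2 μ hμ).add (hY.2 μ hμ)⟩

theorem LRdom_smul (hX : X ∈ LRdom D) (c : ℝ) : c • X ∈ LRdom D :=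
  ⟨hX.1.const_smul c, fun μ hμ => (hX.2 μ hμ).smul c⟩

theorem LRdom_sub (hX : X ∈ LRdom D) (hY : Y ∈ LRdom D) : X - Y ∈ LRdom D :=
  ⟨hX.1.sub hY.1, fun μ hμ => (hX.2 μ hμ).sub (hY.2 μ hμ)⟩

theorem mem_MRdom_of_bounded (hX : X ∈ LRdom D) (hC : ∃ C : ℝ, ∀ ω, |X ω| ≤ C) :
    X ∈ MRdom D β := by
  refine ⟨hX, fun ε hε => ⟨X, hX.1, hC, ?_⟩⟩
  rw [Mnorm_eq_zero_of_ae_eq_zero fun μ _ => .of_forall fun ω => sub_self _]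
  simpa using hε

end MinkowskiGauge

/-- `ℓ` is linear on `LRdom D` and bounded there by `M` times the Minkowski norm. -/
structure IsBoundedFunctional (D : Set (Measure Ω)) (β : Measure Ω → ℝ)
    (ℓ : (Ω → ℝ) → ℝ) (M : ℝ) : Prop where
  map_add : ∀ X ∈ LRdom D, ∀ Y ∈ LRdom D, ℓ (X + Y) = ℓ X + ℓ Y
  map_smul : ∀ X ∈ LRdom D, ∀ c : ℝ, ℓ (c • X) = c * ℓ X
  bound : ∀ X ∈ LRdom D, |ℓ X| ≤ M * (Mnorm D β X).toReal

namespace IsBoundedFunctional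

variable {D : Set (Measure Ω)} {β : Measure Ω → ℝ} {ℓ : (Ω → ℝ) → ℝ} {M : ℝ} {X Y : Ω → ℝ}

theorem map_sub (h : IsBoundedFunctional D β ℓ M) (hX : X ∈ LRdom D) (hY : Y ∈ LRdom D) :
    ℓ (X - Y) = ℓ X - ℓ Y := by
  have := h.map_add _ (LRdom_sub hX hY) _ hY
  rw [sub_add_cancel] at this
  linarith

/-- Solidity of the norm turns the bound at `Y` into the bound at any dominating `X`. -/
theorem abs_le_of_abs_le (h : IsBoundedFunctional D β ℓ M) (hX : X ∈ LRdom D)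
    (hfin : Mnorm D β X ≠ ⊤) (hY : Measurable Y) (hle : ∀ ω, |Y ω| ≤ |X ω|) :
    |ℓ Y| ≤ M * (Mnorm D β X).toReal := by
  have hYX : (Mnorm D β Y).toReal ≤ (Mnorm D β X).toReal :=
    ENNReal.toReal_mono hfin (Mnorm_mono hle)
  have hbY := h.bound Y (LRdom_of_abs_le hX hY hle)
  have hbX := h.bound X hX
  rcases le_or_gt 0 M with hM | hM
  · exact hbY.trans (mul_le_mul_of_nonneg_left hYX hM)
  · have := abs_nonneg (ℓ X)
    have := abs_nonneg (ℓ Y)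
    have : (Mnorm D β X).toReal = 0 := by
      refine le_antisymm ?_ ENNReal.toReal_nonneg
      nlinarith
    have : (Mnorm D β Y).toReal = 0 := by
      refine le_antisymm (by linarith) ENNReal.toReal_nonneg
    simp_all

/-- If some element of the domain has infinite norm, the functional is trivial. -/
theorem eq_zero_of_Mnorm_eq_top (h : IsBoundedFunctional D β ℓ M) (hX : X ∈ LRdom D)
    (htop : Mnorm D β X = ⊤) (hY : Y ∈ LRdom D) : ℓ Y = 0 := by
  have habs : |X| ∈ LRdom D := LRdom_of_abs_le hX hX.1.abs fun ω => by simp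
  have hzero : ∀ Z, (∀ ω, |X ω| ≤ |Z ω|) → Z ∈ LRdom D → ℓ Z = 0 := by
    intro Z hle hZ
    have htopZ : Mnorm D β Z = ⊤ := top_le_iff.1 (htop ▸ Mnorm_mono hle)
    simpa [htopZ] using h.bound Z hZ
  have hnonneg : ∀ Z ∈ LRdom D, (∀ ω, 0 ≤ Z ω) → ℓ Z = 0 := by
    intro Z hZ hZ0
    have h1 := hzero |X| (fun ω => by simp) habs
    have h2 := hzero (|X| + Z) (fun ω => by
      rw [Pi.add_apply, Pi.abs_apply]
      exact (le_add_of_nonneg_right (hZ0 ω)).trans (le_abs_self _)) (LRdom_add habs hZ)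
    rw [h.map_add _ habs _ hZ, h1, zero_add] at h2
    exact h2
  have hYabs : |Y| ∈ LRdom D := LRdom_of_abs_le hY hY.1.abs fun ω => by simp
  have h1 := hnonneg (|Y| + Y) (LRdom_add hYabs hY) fun ω => by
    simpa using neg_le_iff_add_nonneg.1 (neg_abs_le (Y ω)) |>.trans_eq (add_comm _ _)
  rw [h.map_add _ hYabs _ hY, hnonneg _ hYabs fun ω => abs_nonneg _, zero_add] at h1
  exact h1

end IsBoundedFunctional

/-- Uniformly bounded integrals of the truncations of `|X|` force integrability of `X`. -/
theorem integrable_of_integral_min_le {ν : Measure Ω} [IsFiniteMeasure ν] {X : Ω → ℝ}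
    (hX : Measurable X) {C : ℝ} (h : ∀ n : ℕ, ∫ ω, min |X ω| n ∂ν ≤ C) : Integrable X ν := by
  refine ⟨hX.aestronglyMeasurable, ?_⟩
  have hlim : ∫⁻ ω, ‖X ω‖ₑ ∂ν ≤ ENNReal.ofReal C := by
    have hmin : ∀ n : ℕ, ∫⁻ ω, ENNReal.ofReal (min |X ω| n) ∂ν ≤ ENNReal.ofReal C := by
      intro n
      rw [← ofReal_integral_eq_lintegral_ofReal]
      · exact ENNReal.ofReal_le_ofReal (h n)
      · refine Integrable.of_bound (hX.abs.min measurable_const).aestronglyMeasurable n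
          (.of_forall fun ω => ?_)
        rw [Real.norm_eq_abs, abs_of_nonneg (by positivity)]
        exact min_le_right _ _
      · exact .of_forall fun ω => by positivity
    refine le_of_tendsto' (lintegral_tendsto_of_tendsto_of_monotone
      (f := fun (n : ℕ) ω => ENNReal.ofReal (min |X ω| n)) (fun n => ?_) ?_ ?_) hmin
    · exact (hX.abs.min measurable_const).ennreal_ofReal.aemeasurable
    · refine .of_forall fun ω n m hnm => ENNReal.ofReal_le_ofReal ?_
      have : (n : ℝ) ≤ m := by exact_mod_cast hnm
      gcongr
    · refine .of_forall fun ω => tendsto_const_nhds.congr' ?_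
      filter_upwards [Filter.eventually_ge_atTop ⌈|X ω|⌉₊] with n hn
      rw [min_eq_left (Nat.ceil_le.1 hn), Real.enorm_eq_ofReal_abs]
  exact hlim.trans_lt ENNReal.ofReal_lt_top

/-- A bounded measurable function is uniformly approximated by simple functions. -/
theorem exists_simpleFunc_abs_sub_le {Y : Ω → ℝ} (hY : Measurable Y) {C : ℝ}
    (hC : ∀ ω, |Y ω| ≤ C) {ε : ℝ} (hε : 0 < ε) :
    ∃ f : SimpleFunc Ω ℝ, ∀ ω, |Y ω - f ω| ≤ ε := by
  have hmeas : Measurable fun ω => ⌊Y ω / ε⌋ := Int.measurable_floor.comp (hY.div_const ε)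
  have hfin : (Set.range fun ω => ⌊Y ω / ε⌋).Finite := by
    refine (Set.finite_Icc ⌊-C / ε⌋ ⌊C / ε⌋).subset ?_
    rintro _ ⟨ω, rfl⟩
    have := abs_le.1 (hC ω)
    exact ⟨Int.floor_mono (by gcongr; exact this.1), Int.floor_mono (by gcongr; exact this.2)⟩
  let g : SimpleFunc Ω ℤ := ⟨_, fun k => hmeas (measurableSet_singleton k), hfin⟩
  refine ⟨g.map fun k : ℤ => ε * k, fun ω => ?_⟩
  have hY' : Y ω - ε * (⌊Y ω / ε⌋ : ℝ) = ε * Int.fract (Y ω / ε) := by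
    rw [← Int.self_sub_floor, mul_sub, mul_div_cancel₀ _ hε.ne']
  change |Y ω - ε * (⌊Y ω / ε⌋ : ℝ)| ≤ ε
  rw [hY', abs_of_nonneg (mul_nonneg hε.le (Int.fract_nonneg _))]
  exact mul_le_of_le_one_right hε.le (Int.fract_lt_one _).le

namespace IsBoundedFunctional

variable {D : Set (Measure Ω)} {β : Measure Ω → ℝ} {ℓ : (Ω → ℝ) → ℝ} {M : ℝ} {X Y : Ω → ℝ}

theorem abs_le_toReal_Mnorm_mul (h : IsBoundedFunctional D β ℓ M)
    (hone : (fun _ => 1 : Ω → ℝ) ∈ LRdom D) (hfin : Mnorm D β (fun _ => 1) ≠ ⊤)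
    {ε : ℝ} (hY : Measurable Y) (hε : ∀ ω, |Y ω| ≤ ε) :
    |ℓ Y| ≤ M * (Mnorm D β fun _ => 1).toReal * ε := by
  rcases isEmpty_or_nonempty Ω with hΩ | ⟨⟨ω₀⟩⟩
  · have hY0 : Y = (0 : ℝ) • fun _ => 1 := Subsingleton.elim _ _
    have hz : ∀ Z : Ω → ℝ, Mnorm D β Z = 0 := fun Z =>
      Mnorm_eq_zero_of_ae_eq_zero fun μ _ => .of_forall fun ω => isEmptyElim ω
    rw [hY0, h.map_smul _ hone, hz]
    simp
  · rcases ((abs_nonneg _).trans (hε ω₀)).eq_or_lt with rfl | hpos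
    · have hY0 : Y = (0 : ℝ) • fun _ => 1 := by
        ext ω
        simpa using hε ω
      rw [hY0, h.map_smul _ hone]
      simp
    · have hb := h.abs_le_of_abs_le hone hfin (hY.const_smul ε⁻¹) fun ω => by
        rw [Pi.smul_apply, smul_eq_mul, abs_mul, abs_inv, abs_of_pos hpos, abs_one]
        exact (inv_mul_le_one₀ hpos).2 (hε ω)
      have hYdom : Y ∈ LRdom D := LRdom_of_abs_le (LRdom_smul hone ε) hY fun ω => by
        simpa [abs_of_pos hpos] using hε ω
      rw [h.map_smul _ hYdom, abs_mul, abs_inv, abs_of_pos hpos, inv_mul_le_iff₀ hpos] at hb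
      linarith

/-- A bounded functional agrees on bounded functions with the integral against a difference of
measures as soon as it does so on indicators. -/
theorem eq_integral_sub_integral_of_bounded (h : IsBoundedFunctional D β ℓ M)
    (hbm : ∀ X : Ω → ℝ, Measurable X → (∃ C : ℝ, ∀ ω, |X ω| ≤ C) → X ∈ LRdom D)
    (hfin : Mnorm D β (fun _ => 1) ≠ ⊤)
    {ν₁ ν₂ : Measure Ω} [IsFiniteMeasure ν₁] [IsFiniteMeasure ν₂]
    (hν : ∀ A, MeasurableSet A → ℓ (A.indicator fun _ => 1) = ν₁.real A - ν₂.real A)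
    (hY : Measurable Y) {C : ℝ} (hC : ∀ ω, |Y ω| ≤ C) :
    ℓ Y = ∫ ω, Y ω ∂ν₁ - ∫ ω, Y ω ∂ν₂ := by
  have hone : (fun _ => 1 : Ω → ℝ) ∈ LRdom D := hbm _ measurable_const ⟨1, by simp⟩
  have hsimple_dom : ∀ f : SimpleFunc Ω ℝ, (f : Ω → ℝ) ∈ LRdom D := fun f =>
    hbm _ f.measurable (f.exists_forall_norm_le)
  have hsimple : ∀ f : SimpleFunc Ω ℝ, ℓ f = ∫ ω, f ω ∂ν₁ - ∫ ω, f ω ∂ν₂ := by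
    intro f
    induction f using SimpleFunc.induction with
    | @const c s hs =>
      have heq : ((SimpleFunc.piecewise s hs (SimpleFunc.const _ c) (SimpleFunc.const _ 0) :
          SimpleFunc Ω ℝ) : Ω → ℝ) = c • s.indicator fun _ => 1 := by
        ext ω
        by_cases hω : ω ∈ s <;> simp [hω]
      have hdom : s.indicator (fun _ => (1 : ℝ)) ∈ LRdom D :=
        hbm _ (measurable_const.indicator hs) ⟨1, fun ω => by
          by_cases hω : ω ∈ s <;> simp [hω]⟩
      rw [heq, h.map_smul _ hdom, hν s hs]
      simp only [Pi.smul_apply, smul_eq_mul, integral_const_mul, integral_indicator_const _ hs]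
      ring
    | @add f g _ hf hg =>
      rw [SimpleFunc.coe_add, h.map_add _ (hsimple_dom f) _ (hsimple_dom g), hf, hg]
      simp only [Pi.add_apply]
      rw [integral_add (f.integrable_of_isFiniteMeasure) (g.integrable_of_isFiniteMeasure),
        integral_add (f.integrable_of_isFiniteMeasure) (g.integrable_of_isFiniteMeasure)]
      ring
  have hYdom := hbm Y hY ⟨C, hC⟩
  have h_int : ∀ ν : Measure Ω, IsFiniteMeasure ν → Integrable Y ν := fun ν _ =>
    .of_bound hY.aestronglyMeasurable C (.of_forall hC)
  have happrox : ∀ ε : ℝ, 0 < ε → |ℓ Y - (∫ ω, Y ω ∂ν₁ - ∫ ω, Y ω ∂ν₂)| ≤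
      (M * (Mnorm D β fun _ => 1).toReal + ν₁.real Set.univ + ν₂.real Set.univ) * ε := by
    intro ε hε
    obtain ⟨f, hf⟩ := exists_simpleFunc_abs_sub_le hY hC hε
    have h1 := h.abs_le_toReal_Mnorm_mul hone hfin (hY.sub f.measurable) hf
    rw [h.map_sub hYdom (hsimple_dom f), hsimple f] at h1
    have h2 : ∀ ν : Measure Ω, IsFiniteMeasure ν →
        |∫ ω, Y ω ∂ν - ∫ ω, f ω ∂ν| ≤ ν.real Set.univ * ε := fun ν _ => by
      rw [← integral_sub (h_int ν inferInstance) f.integrable_of_isFiniteMeasure, mul_comm]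
      exact norm_integral_le_of_norm_le_const (f := fun ω => Y ω - f ω) (.of_forall hf)
    have h3 := abs_le.1 (h2 ν₁ inferInstance)
    have h4 := abs_le.1 (h2 ν₂ inferInstance)
    have h5 := abs_le.1 h1
    exact abs_le.2 ⟨by linarith, by linarith⟩
  set K := M * (Mnorm D β fun _ => 1).toReal + ν₁.real Set.univ + ν₂.real Set.univ
  refine sub_eq_zero.1 (abs_nonpos_iff.1 (le_of_forall_pos_le_add fun δ hδ => ?_))
  have hpos : 0 < |K| + 1 := by positivity
  refine (happrox (δ / (|K| + 1)) (by positivity)).trans ?_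
  rw [zero_add, mul_div_assoc', div_le_iff₀ hpos, mul_comm]
  exact mul_le_mul_of_nonneg_left ((le_abs_self K).trans (by linarith)) hδ.le

/-- Countable additivity and the Jordan decomposition of `A ↦ ℓ 1_A`. -/
theorem exists_measures_of_tendsto (h : IsBoundedFunctional D β ℓ M)
    (hbm : ∀ X : Ω → ℝ, Measurable X → (∃ C : ℝ, ∀ ω, |X ω| ≤ C) → X ∈ LRdom D)
    (hfin : ∀ X ∈ LRdom D, Mnorm D β X ≠ ⊤)
    (hca : ∀ A : ℕ → Set Ω, (∀ n, MeasurableSet (A n)) →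
      (∀ n m : ℕ, n ≤ m → A m ⊆ A n) → (⋂ n, A n) = ∅ →
      Filter.Tendsto (fun n => Mnorm D β (Set.indicator (A n) fun _ => (1 : ℝ)))
        Filter.atTop (nhds 0)) :
    ∃ ν₁ ν₂ : Measure Ω, IsFiniteMeasure ν₁ ∧ IsFiniteMeasure ν₂ ∧ ν₁ ⟂ₘ ν₂ ∧
      ∀ A, MeasurableSet A → ℓ (A.indicator fun _ => 1) = ν₁.real A - ν₂.real A := by
  classical
  have hdom : ∀ A : Set Ω, MeasurableSet A → A.indicator (fun _ => (1 : ℝ)) ∈ LRdom D :=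
    fun A hA => hbm _ (measurable_const.indicator hA) ⟨1, fun ω => by
      by_cases hω : ω ∈ A <;> simp [hω]⟩
  have hempty : ℓ ((∅ : Set Ω).indicator fun _ => 1) = 0 := by
    rw [Set.indicator_empty']
    simpa only [zero_smul, zero_mul] using h.map_smul _ (hdom ∅ .empty) 0
  have hunion : ∀ A B : Set Ω, MeasurableSet A → MeasurableSet B → Disjoint A B →
      ℓ ((A ∪ B).indicator fun _ => 1) =
        ℓ (A.indicator fun _ => 1) + ℓ (B.indicator fun _ => 1) := by
    intro A B hA hB hAB
    rw [← h.map_add _ (hdom A hA) _ (hdom B hB), Set.indicator_union_of_disjoint hAB]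
    rfl
  let s : SignedMeasure Ω :=
    { measureOf' := fun A => if MeasurableSet A then ℓ (A.indicator fun _ => 1) else 0
      empty' := by simpa using hempty
      not_measurable' := fun A hA => if_neg hA
      m_iUnion' := by
        intro f hf hdisj
        simp only [hf, if_true, MeasurableSet.iUnion hf]
        let T : ℕ → Set Ω := fun n => ⋃ i ≥ n, f i
        have hTm : ∀ n, MeasurableSet (T n) := fun n =>
          .iUnion fun i => .iUnion fun _ => hf i
        have hTempty : (⋂ n, T n) = ∅ := by
          refine Set.eq_empty_iff_forall_notMem.2 fun ω hω => ?_
          simp only [T, Set.mem_iInter, Set.mem_iUnion] at hω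
          obtain ⟨i, -, hi⟩ := hω 0
          obtain ⟨j, hj, hj'⟩ := hω (i + 1)
          exact Set.disjoint_left.1 (hdisj (show i ≠ j by omega)) hi hj'
        have hTanti : ∀ n m : ℕ, n ≤ m → T m ⊆ T n := fun n m hnm =>
          Set.biUnion_subset_biUnion_left fun i hi => le_trans hnm hi
        have hlim : Filter.Tendsto
            (fun n => M * (Mnorm D β ((T n).indicator fun _ => (1 : ℝ))).toReal)
            Filter.atTop (nhds 0) := by
          simpa using ((ENNReal.tendsto_toReal ENNReal.zero_ne_top).comp
            (hca T hTm hTanti hTempty)).const_mul M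
        have hfinset : ∀ t : Finset ℕ, ℓ ((⋃ i ∈ t, f i).indicator fun _ => 1) =
            ∑ i ∈ t, ℓ ((f i).indicator fun _ => 1) := by
          intro t
          induction t using Finset.induction_on with
          | empty => simpa using hempty
          | insert a t hat ih =>
            rw [Finset.sum_insert hat, Finset.set_biUnion_insert, hunion _ _ (hf a)
              (t.measurableSet_biUnion fun i _ => hf i), ih]
            exact Set.disjoint_iUnion₂_right.2 fun i hi =>
              hdisj (show a ≠ i from fun hai => hat (hai ▸ hi))
        rw [HasSum, SummationFilter.unconditional_filter, Metric.tendsto_nhds]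
        intro ε hε
        obtain ⟨n, hn⟩ := (hlim.eventually (gt_mem_nhds hε)).exists
        filter_upwards [Filter.eventually_ge_atTop (Finset.range n)] with t ht
        have htm : MeasurableSet (⋃ i ∈ t, f i) := t.measurableSet_biUnion fun i _ => hf i
        have hRm : MeasurableSet ((⋃ i, f i) \ ⋃ i ∈ t, f i) := (MeasurableSet.iUnion hf).diff htm
        have hsplit := hunion _ _ htm hRm Set.disjoint_sdiff_right
        rw [Set.union_sdiff_cancel (Set.iUnion₂_subset_iUnion _ _), hfinset] at hsplit
        have hRT : (⋃ i, f i) \ (⋃ i ∈ t, f i) ⊆ T n := by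
          rintro ω ⟨hω, hωt⟩
          obtain ⟨i, hi⟩ := Set.mem_iUnion.1 hω
          refine Set.mem_biUnion (show i ≥ n from ?_) hi
          by_contra! hin
          exact hωt (Set.mem_biUnion (ht (Finset.mem_range.2 hin)) hi)
        have hb := h.abs_le_of_abs_le (hdom _ (hTm n)) (hfin _ (hdom _ (hTm n)))
          (hdom _ hRm).1 fun ω => by
            by_cases hω : ω ∈ (⋃ i, f i) \ ⋃ i ∈ t, f i
            · rw [Set.indicator_of_mem hω, Set.indicator_of_mem (hRT hω)]
            · rw [Set.indicator_of_notMem hω, abs_zero]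
              exact abs_nonneg _
        rw [dist_comm, Real.dist_eq, hsplit, add_sub_cancel_left]
        exact hb.trans_lt hn }
  refine ⟨s.toJordanDecomposition.posPart, s.toJordanDecomposition.negPart, inferInstance,
    inferInstance, s.toJordanDecomposition.mutuallySingular, fun A hA => ?_⟩
  rw [← s.apply_eq_posPart_real_sub_negPart_real hA]
  exact (if_pos hA).symm

/-- If mutually singular finite measures represent a bounded functional on bounded functions,
then their difference integrates the whole domain, with the same bound. -/
theorem integrable_and_abs_integral_sub_le (h : IsBoundedFunctional D β ℓ M)
    (hfin : ∀ X ∈ LRdom D, Mnorm D β X ≠ ⊤)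
    {ν₁ ν₂ : Measure Ω} [IsFiniteMeasure ν₁] [IsFiniteMeasure ν₂] (hsing : ν₁ ⟂ₘ ν₂)
    (hbdd : ∀ Y : Ω → ℝ, Measurable Y → ∀ C : ℝ, (∀ ω, |Y ω| ≤ C) →
      ℓ Y = ∫ ω, Y ω ∂ν₁ - ∫ ω, Y ω ∂ν₂) (hX : X ∈ LRdom D) :
    Integrable X ν₁ ∧ Integrable X ν₂ ∧
      |∫ ω, X ω ∂ν₁ - ∫ ω, X ω ∂ν₂| ≤ M * (Mnorm D β X).toReal := by
  obtain ⟨S, hS, hS₁, hS₂⟩ := hsing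
  have htrunc : ∀ (T : Set Ω), MeasurableSet T → ∀ n : ℕ,
      |∫ ω in T, min |X ω| n ∂ν₁ - ∫ ω in T, min |X ω| n ∂ν₂| ≤ M * (Mnorm D β X).toReal := by
    intro T hT n
    have hm : Measurable (T.indicator fun ω => min |X ω| n) :=
      (hX.1.abs.min measurable_const).indicator hT
    have h0 : ∀ ω, 0 ≤ min |X ω| (n : ℝ) := fun ω => by positivity
    have hle : ∀ ω, |T.indicator (fun ω => min |X ω| n) ω| ≤ min |X ω| n := fun ω => by
      by_cases hω : ω ∈ T
      · rw [Set.indicator_of_mem hω, abs_of_nonneg (h0 ω)]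
      · simp [hω]
    have hb := h.abs_le_of_abs_le hX (hfin X hX) hm fun ω => (hle ω).trans (min_le_left _ _)
    rwa [hbdd _ hm n fun ω => (hle ω).trans (min_le_right _ _), integral_indicator hT,
      integral_indicator hT] at hb
  have hres₁ : ν₁.restrict Sᶜ = ν₁ := Measure.restrict_eq_self_of_ae_mem
    (by rwa [← compl_compl S, ← mem_ae_iff] at hS₁)
  have hres₂ : ν₂.restrict S = ν₂ := Measure.restrict_eq_self_of_ae_mem
    (by rwa [← mem_ae_iff] at hS₂)
  have h_int₁ : Integrable X ν₁ := integrable_of_integral_min_le hX.1 fun n => by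
    have := htrunc Sᶜ hS.compl n
    rw [hres₁, Measure.restrict_eq_zero.2 hS₂, integral_zero_measure, sub_zero] at this
    exact (le_abs_self _).trans this
  have h_int₂ : Integrable X ν₂ := integrable_of_integral_min_le hX.1 fun n => by
    have := htrunc S hS n
    rw [hres₂, Measure.restrict_eq_zero.2 hS₁, integral_zero_measure, zero_sub, abs_neg] at this
    exact (le_abs_self _).trans this
  refine ⟨h_int₁, h_int₂, ?_⟩
  let Z : ℕ → Ω → ℝ := fun n => {ω | |X ω| ≤ n}.indicator X
  have hZm : ∀ n, Measurable (Z n) := fun n =>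
    hX.1.indicator (measurableSet_le hX.1.abs measurable_const)
  have hZX : ∀ n ω, |Z n ω| ≤ |X ω| := fun n ω => by
    by_cases hω : |X ω| ≤ n <;> simp [Z, hω]
  have hZn : ∀ n ω, |Z n ω| ≤ n := fun n ω => by
    by_cases hω : |X ω| ≤ n <;> simp [Z, hω]
  have hlim : ∀ ν : Measure Ω, Integrable X ν →
      Filter.Tendsto (fun n => ∫ ω, Z n ω ∂ν) Filter.atTop (nhds (∫ ω, X ω ∂ν)) := fun ν hν => by
    refine tendsto_integral_of_dominated_convergence (fun ω => |X ω|)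
      (fun n => (hZm n).aestronglyMeasurable) hν.abs (fun n => .of_forall (hZX n))
      (.of_forall fun ω => tendsto_const_nhds.congr' ?_)
    filter_upwards [Filter.eventually_ge_atTop ⌈|X ω|⌉₊] with n hn
    exact (Set.indicator_of_mem (show ω ∈ {ω | |X ω| ≤ n} from Nat.ceil_le.1 hn) X).symm
  refine le_of_tendsto' ((hlim ν₁ h_int₁).sub (hlim ν₂ h_int₂)).abs fun n => ?_
  rw [← hbdd _ (hZm n) n (hZn n)]
  exact h.abs_le_of_abs_le hX (hfin X hX) (hZm n) (hZX n)

/-- A functional represented by measures on bounded functions is represented by them on the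
closure of the bounded functions. -/
theorem eq_integral_sub_integral_of_mem_MRdom (h : IsBoundedFunctional D β ℓ M)
    (hbm : ∀ X : Ω → ℝ, Measurable X → (∃ C : ℝ, ∀ ω, |X ω| ≤ C) → X ∈ LRdom D)
    {ν₁ ν₂ : Measure Ω}
    (hbdd : ∀ Y : Ω → ℝ, Measurable Y → ∀ C : ℝ, (∀ ω, |Y ω| ≤ C) →
      ℓ Y = ∫ ω, Y ω ∂ν₁ - ∫ ω, Y ω ∂ν₂)
    (h_int : ∀ X ∈ LRdom D, Integrable X ν₁ ∧ Integrable X ν₂ ∧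
      |∫ ω, X ω ∂ν₁ - ∫ ω, X ω ∂ν₂| ≤ M * (Mnorm D β X).toReal)
    (hX : X ∈ MRdom D β) : ℓ X = ∫ ω, X ω ∂ν₁ - ∫ ω, X ω ∂ν₂ := by
  refine sub_eq_zero.1 (abs_nonpos_iff.1 (le_of_forall_pos_le_add fun δ hδ => ?_))
  have hpos : 0 < 2 * |M| + 1 := by positivity
  have hε : 0 < δ / (2 * |M| + 1) := by positivity
  obtain ⟨Y, hY, ⟨C, hC⟩, hXY⟩ := hX.2 _ hε
  have hYdom := hbm Y hY ⟨C, hC⟩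
  have hsub := LRdom_sub hX.1 hYdom
  have hnorm : (Mnorm D β (X - Y)).toReal ≤ δ / (2 * |M| + 1) :=
    ENNReal.toReal_le_of_le_ofReal hε.le hXY.le
  have hMle : M * (Mnorm D β (X - Y)).toReal ≤ |M| * (δ / (2 * |M| + 1)) :=
    (mul_le_mul_of_nonneg_right (le_abs_self M) ENNReal.toReal_nonneg).trans
      (mul_le_mul_of_nonneg_left hnorm (abs_nonneg M))
  have h1 := h.bound _ hsub
  rw [h.map_sub hX.1 hYdom, hbdd Y hY C hC] at h1
  have h2 := (h_int _ hsub).2.2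
  simp only [Pi.sub_apply] at h2
  rw [integral_sub (h_int X hX.1).1 (h_int Y hYdom).1,
    integral_sub (h_int X hX.1).2.1 (h_int Y hYdom).2.1] at h2
  have hδ' : 2 * (|M| * (δ / (2 * |M| + 1))) ≤ δ := by
    rw [← mul_assoc, mul_div_assoc', div_le_iff₀ hpos]
    nlinarith
  have h3 := abs_le.1 h1
  have h4 := abs_le.1 h2
  exact abs_le.2 ⟨by linarith, by linarith⟩

end IsBoundedFunctional

/-- Two differences of finite measures with equal values on measurable sets have the same
integrals. -/
theorem integral_sub_integral_eq_of_real_sub_eq {ν₁ ν₂ ν₁' ν₂' : Measure Ω}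
    [IsFiniteMeasure ν₁] [IsFiniteMeasure ν₂] [IsFiniteMeasure ν₁'] [IsFiniteMeasure ν₂']
    (h : ∀ A, MeasurableSet A → ν₁.real A - ν₂.real A = ν₁'.real A - ν₂'.real A) {X : Ω → ℝ}
    (h₁ : Integrable X ν₁) (h₂ : Integrable X ν₂) (h₁' : Integrable X ν₁')
    (h₂' : Integrable X ν₂') :
    ∫ ω, X ω ∂ν₁ - ∫ ω, X ω ∂ν₂ = ∫ ω, X ω ∂ν₁' - ∫ ω, X ω ∂ν₂' := by
  have heq : ν₁ + ν₂' = ν₁' + ν₂ := by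
    ext A hA
    rw [← measureReal_eq_measureReal_iff, measureReal_add_apply, measureReal_add_apply]
    linarith [h A hA]
  have := congrArg (fun ν => ∫ ω, X ω ∂ν) heq
  simp only [integral_add_measure h₁ h₂', integral_add_measure h₁' h₂] at this
  linarith

/-- If the values on null sets vanish, both parts of a Jordan decomposition are absolutely
continuous. -/
theorem absolutelyContinuous_of_mutuallySingular {P ν₁ ν₂ : Measure Ω} [IsFiniteMeasure ν₁]
    [IsFiniteMeasure ν₂] (hsing : ν₁ ⟂ₘ ν₂)
    (h : ∀ A, MeasurableSet A → P A = 0 → ν₁.real A - ν₂.real A = 0) : ν₁ ≪ P ∧ ν₂ ≪ P := by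
  have key : ∀ ν ν' : Measure Ω, IsFiniteMeasure ν → ν ⟂ₘ ν' →
      (∀ A, MeasurableSet A → P A = 0 → ν.real A = ν'.real A) → ν ≪ P := by
    intro ν ν' _ hsing' h'
    obtain ⟨S, hS, hS₁, hS₂⟩ := hsing'
    refine Measure.AbsolutelyContinuous.mk fun A hA hPA => ?_
    have hA' := h' (A \ S) (hA.diff hS) (measure_mono_null Set.sdiff_subset hPA)
    rw [measureReal_def ν', measure_mono_null (Set.sdiff_subset_compl A S) hS₂, ENNReal.toReal_zero,
      measureReal_eq_zero_iff] at hA'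
    rwa [measure_sdiff_null hS₁] at hA'
  exact ⟨key ν₁ ν₂ inferInstance hsing fun A hA hP => sub_eq_zero.1 (h A hA hP),
    key ν₂ ν₁ inferInstance hsing.symm fun A hA hP => (sub_eq_zero.1 (h A hA hP)).symm⟩

theorem stmt17 (P : Measure Ω) [IsProbabilityMeasure P]
    (D : Set (Measure Ω)) (hD : D.Nonempty)
    (hDfin : ∀ μ ∈ D, IsFiniteMeasure μ) (hDac : ∀ μ ∈ D, μ ≪ P)
    (β : Measure Ω → ℝ) (hβ : ∀ μ ∈ D, 0 ≤ β μ)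
    (hβinf : ⨅ μ ∈ D, ENNReal.ofReal (β μ) = 0)
    -- L^∞ ⊆ L^R (bounded measurable functions belong to the domain)
    (hbm : ∀ X : Ω → ℝ, Measurable X → (∃ C : ℝ, ∀ ω, |X ω| ≤ C) → X ∈ LRdom D)
    -- continuity from above of the underlying risk measure:
    -- ρ(λ 1_{A_n}) → 0 whenever A_n ↓ ∅
    (hca : ∀ l : ℝ, 0 < l → ∀ A : ℕ → Set Ω, (∀ n, MeasurableSet (A n)) →
      (∀ n m : ℕ, n ≤ m → A m ⊆ A n) → (⋂ n, A n) = ∅ →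
      Filter.Tendsto
        (fun n => rhoE D β (fun ω => l * Set.indicator (A n) (fun _ => (1 : ℝ)) ω))
        Filter.atTop (nhds 0))
    -- ℓ is a continuous linear functional on (L^R, ‖·‖_R)
    (ℓ : (Ω → ℝ) → ℝ)
    (hadd : ∀ X ∈ LRdom D, ∀ Y ∈ LRdom D, ℓ (X + Y) = ℓ X + ℓ Y)
    (hsmul : ∀ X ∈ LRdom D, ∀ c : ℝ, ℓ (c • X) = c * ℓ X)
    (M : ℝ) (hM : ∀ X ∈ LRdom D, |ℓ X| ≤ M * (Mnorm D β X).toReal) :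
    -- (a) A ↦ ℓ(1_A) is countably additive
    (∀ A : ℕ → Set Ω, (∀ n, MeasurableSet (A n)) →
      (∀ n m : ℕ, n ≤ m → A m ⊆ A n) → (⋂ n, A n) = ∅ →
      Filter.Tendsto (fun n => ℓ (Set.indicator (A n) (fun _ => (1 : ℝ))))
        Filter.atTop (nhds 0)) ∧
    -- (b) existence of the decomposition ℓ = μ ⊕ λ with μ ∈ ca_ℙ regular
    (∃ ν₁ ν₂ : Measure Ω, IsFiniteMeasure ν₁ ∧ IsFiniteMeasure ν₂ ∧
      ν₁ ≪ P ∧ ν₂ ≪ P ∧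
      -- every X ∈ L^R is integrable for the regular part, which is a bounded
      -- functional with the same bound
      (∀ X ∈ LRdom D, Integrable X ν₁ ∧ Integrable X ν₂ ∧
        |∫ ω, X ω ∂ν₁ - ∫ ω, X ω ∂ν₂| ≤ M * (Mnorm D β X).toReal) ∧
      -- the singular part λ = ℓ - ∫ · d(ν₁ - ν₂) vanishes on M^R
      (∀ X ∈ MRdom D β, ℓ X = ∫ ω, X ω ∂ν₁ - ∫ ω, X ω ∂ν₂) ∧
      -- (c) uniqueness of the regular part
      (∀ ν₁' ν₂' : Measure Ω, IsFiniteMeasure ν₁' → IsFiniteMeasure ν₂' →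
        ν₁' ≪ P → ν₂' ≪ P →
        (∀ X ∈ LRdom D, Integrable X ν₁' ∧ Integrable X ν₂') →
        (∀ X ∈ MRdom D β, ℓ X = ∫ ω, X ω ∂ν₁' - ∫ ω, X ω ∂ν₂') →
        ∀ X ∈ LRdom D,
          ∫ ω, X ω ∂ν₁ - ∫ ω, X ω ∂ν₂ = ∫ ω, X ω ∂ν₁' - ∫ ω, X ω ∂ν₂')) := by
  have h : IsBoundedFunctional D β ℓ M := ⟨hadd, hsmul, hM⟩
  have hdom : ∀ A : Set Ω, MeasurableSet A → A.indicator (fun _ => (1 : ℝ)) ∈ LRdom D ∧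
      A.indicator (fun _ => (1 : ℝ)) ∈ MRdom D β := fun A hA => by
    have hb : ∃ C : ℝ, ∀ ω, |A.indicator (fun _ => (1 : ℝ)) ω| ≤ C := ⟨1, fun ω => by
      by_cases hω : ω ∈ A <;> simp [hω]⟩
    have hmem := hbm _ (measurable_const.indicator hA) hb
    exact ⟨hmem, mem_MRdom_of_bounded hmem hb⟩
  have hcaM := fun (A : ℕ → Set Ω) hA hanti hempty =>
    tendsto_Mnorm_indicator (D := D) (β := β) fun l hl => hca l hl A hA hanti hempty
  refine ⟨fun A hA hanti hempty => ?_, ?_⟩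
  · refine squeeze_zero_norm (fun n => hM _ (hdom _ (hA n)).1) ?_
    simpa using ((ENNReal.tendsto_toReal ENNReal.zero_ne_top).comp
      (hcaM A hA hanti hempty)).const_mul M
  suffices hex : ∃ ν₁ ν₂ : Measure Ω, IsFiniteMeasure ν₁ ∧ IsFiniteMeasure ν₂ ∧
      ν₁ ≪ P ∧ ν₂ ≪ P ∧
      (∀ X ∈ LRdom D, Integrable X ν₁ ∧ Integrable X ν₂ ∧
        |∫ ω, X ω ∂ν₁ - ∫ ω, X ω ∂ν₂| ≤ M * (Mnorm D β X).toReal) ∧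
      (∀ X ∈ MRdom D β, ℓ X = ∫ ω, X ω ∂ν₁ - ∫ ω, X ω ∂ν₂) by
    obtain ⟨ν₁, ν₂, hf₁, hf₂, hac₁, hac₂, h_int, hrep⟩ := hex
    refine ⟨ν₁, ν₂, hf₁, hf₂, hac₁, hac₂, h_int, hrep, ?_⟩
    intro ν₁' ν₂' hf₁' hf₂' _ _ h_int' hrep' X hX
    refine integral_sub_integral_eq_of_real_sub_eq (fun A hA => ?_) (h_int X hX).1 (h_int X hX).2.1
      (h_int' X hX).1 (h_int' X hX).2
    have heq := (hrep _ (hdom A hA).2).symm.trans (hrep' _ (hdom A hA).2)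
    simpa [integral_indicator_const _ hA] using heq
  by_cases hfin : ∀ X ∈ LRdom D, Mnorm D β X ≠ ⊤
  · obtain ⟨ν₁, ν₂, hf₁, hf₂, hsing, hν⟩ := h.exists_measures_of_tendsto hbm hfin hcaM
    have hone := hfin _ (hbm (fun _ => 1) measurable_const ⟨1, by simp⟩)
    have hbdd : ∀ Y : Ω → ℝ, Measurable Y → ∀ C : ℝ, (∀ ω, |Y ω| ≤ C) →
        ℓ Y = ∫ ω, Y ω ∂ν₁ - ∫ ω, Y ω ∂ν₂ := fun Y hY C hC =>
      h.eq_integral_sub_integral_of_bounded hbm hone hν hY hC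
    have hac := absolutelyContinuous_of_mutuallySingular (P := P) hsing fun A hA hPA => by
      rw [← hν A hA]
      have hz : Mnorm D β (A.indicator fun _ => (1 : ℝ)) = 0 :=
        Mnorm_eq_zero_of_ae_eq_zero fun μ hμ => indicator_meas_zero (hDac μ hμ hPA)
      simpa [hz] using hM _ (hdom A hA).1
    have h_int := fun X (hX : X ∈ LRdom D) =>
      h.integrable_and_abs_integral_sub_le hfin hsing hbdd hX
    exact ⟨ν₁, ν₂, hf₁, hf₂, hac.1, hac.2, h_int, fun X hX =>
      h.eq_integral_sub_integral_of_mem_MRdom hbm hbdd h_int hX⟩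
  · push Not at hfin
    obtain ⟨X₀, hX₀, htop⟩ := hfin
    have hzero := fun X (hX : X ∈ LRdom D) => h.eq_zero_of_Mnorm_eq_top hX₀ htop hX
    refine ⟨0, 0, inferInstance, inferInstance, .zero P, .zero P, fun X hX => ?_, fun X hX => ?_⟩
    · refine ⟨integrable_zero_measure, integrable_zero_measure, ?_⟩
      simpa [hzero X hX] using hM X hX
    · simp [hzero X hX.1]
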